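/- Let E be a centrally orthocomplete pseudo-effect algebra and h ∈ E. Then the following are equivalent: (i) h is a monad; (ii) h is both subcentral and boolean; (iii) for all e ∈ E[0,h], γe = γh implies e = h; (iv) for all e ∈ E[0,h], e∼ₕ ≤ (γe)' and e⁻ₕ ≤ (γe)'; (v) for all e,f ∈ E[0,h], e +ₕ f exists if and only if γe ∧ γf = 0. -/

import Mathlib

namespace PEApaper

/-- The bare data of a partial-addition structure: a partial binary operation
(encoded via `Option`) together with constants `0` and `1`. -/
structure PartialStruct (E : Type) where
  padd : E → E → Option E
  zero : E
  one : E

namespace PartialStruct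

variable {E : Type}

/-- `a ≤ b` iff `a + c = b` for some `c`. -/
def le (P : PartialStruct E) (a b : E) : Prop := ∃ c, P.padd a c = some b

/-- `m` is the greatest lower bound (meet `a ∧ b`) of `a` and `b`. -/
def IsMeet (P : PartialStruct E) (a b m : E) : Prop :=
  P.le m a ∧ P.le m b ∧ ∀ x, P.le x a → P.le x b → P.le x m

/-- `j` is the least upper bound (join `a ∨ b`) of `a` and `b`. -/
def IsJoin (P : PartialStruct E) (a b j : E) : Prop :=
  P.le a j ∧ P.le b j ∧ ∀ x, P.le a x → P.le b x → P.le j x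

/-- `s` is the supremum of the set `S`. -/
def IsSup (P : PartialStruct E) (S : Set E) (s : E) : Prop :=
  (∀ x ∈ S, P.le x s) ∧ ∀ u, (∀ x ∈ S, P.le x u) → P.le s u

/-- Left-associated partial sum of a list, continuing from `acc`. -/
def IsSumFrom (P : PartialStruct E) : E → List E → E → Prop
  | acc, [], s => s = acc
  | acc, a :: l, s => ∃ t, P.padd acc a = some t ∧ IsSumFrom P t l s

/-- `s` is the (left-associated) orthosum `e₁ + e₂ + ⋯ + eₙ` of the list. -/
def IsSumList (P : PartialStruct E) (l : List E) (s : E) : Prop :=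
  match l with
  | [] => s = P.zero
  | a :: t => IsSumFrom P a t s

/-- `c` is a central element: there is a PEA-isomorphism
`f : E → E[0,c] × E[0,c∼]` with `f c = (c,0)` such that `f x = (x₁,x₂)`
implies `x = x₁ + x₂`.  The isomorphism onto the product of the two
interval pseudo-effect algebras is spelled out explicitly. -/
def IsCentral (P : PartialStruct E) (c : E) : Prop :=
  ∃ cs, P.padd c cs = some P.one ∧
    ∃ f : E → E × E,
      (∀ x, P.le (f x).1 c ∧ P.le (f x).2 cs) ∧
      Function.Injective f ∧
      (∀ y : E × E, P.le y.1 c → P.le y.2 cs → ∃ x, f x = y) ∧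
      f c = (c, P.zero) ∧
      f P.one = (c, cs) ∧
      (∀ x, P.padd (f x).1 (f x).2 = some x) ∧
      (∀ a b ab, P.padd a b = some ab →
        P.padd (f a).1 (f b).1 = some (f ab).1 ∧
        P.padd (f a).2 (f b).2 = some (f ab).2) ∧
      (∀ a b s t, P.padd (f a).1 (f b).1 = some s → P.le s c →
        P.padd (f a).2 (f b).2 = some t → P.le t cs →
        ∃ ab, P.padd a b = some ab)

/-- The center `Γ(E)`. -/
def center (P : PartialStruct E) : Set E := {c | P.IsCentral c}

/-- The central interval `Γ(E)[0,c] = Γ(E) ∩ E[0,c]`. -/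
def centerIntervalSet (P : PartialStruct E) (c : E) : Set E :=
  {x | P.IsCentral x ∧ P.le x c}

/-- A Γ-orthogonal family: one dominated elementwise by a pairwise
disjoint family of central elements. -/
def GammaOrthogonal (P : PartialStruct E) {I : Type} (e : I → E) : Prop :=
  ∃ c : I → E, (∀ i, P.IsCentral (c i)) ∧
    (∀ i j, i ≠ j → P.IsMeet (c i) (c j) P.zero) ∧
    ∀ i, P.le (e i) (c i)

/-- Centrally orthocomplete: every Γ-orthogonal family has a supremum. -/
def IsCOPEA (P : PartialStruct E) : Prop :=
  ∀ (I : Type) (e : I → E), P.GammaOrthogonal e → ∃ s, P.IsSup (Set.range e) s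

/-- `c` is the central cover of `e`: the smallest central element above `e`. -/
def IsCentralCover (P : PartialStruct E) (c e : E) : Prop :=
  P.IsCentral c ∧ P.le e c ∧ ∀ d, P.IsCentral d → P.le e d → P.le c d

/-- `[Q]`: the set of all suprema of Γ-orthogonal families of elements of `Q`. -/
def bra (P : PartialStruct E) (Q : Set E) : Set E :=
  {s | ∃ (I : Type) (e : I → E), (∀ i, e i ∈ Q) ∧ P.GammaOrthogonal e ∧
    P.IsSup (Set.range e) s}

/-- `Q^γ = {q ∧ c : q ∈ Q, c ∈ Γ(E)}`. -/
def gammaClosure (P : PartialStruct E) (Q : Set E) : Set E :=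
  {m | ∃ q ∈ Q, ∃ c, P.IsCentral c ∧ P.IsMeet q c m}

/-- `Q↓ = ⋃_{q ∈ Q} E[0,q]`. -/
def downSet (P : PartialStruct E) (Q : Set E) : Set E :=
  {e | ∃ q ∈ Q, P.le e q}

/-- `Q' = {e ∈ E : q ∧ e = 0 for all q ∈ Q}`. -/
def commutant (P : PartialStruct E) (Q : Set E) : Set E :=
  {e | ∀ q ∈ Q, P.IsMeet q e P.zero}

/-- A type-determining (TD) set: `K = [K] = K^γ`. -/
def IsTD (P : PartialStruct E) (K : Set E) : Prop :=
  P.bra K = K ∧ P.gammaClosure K = K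

/-- A strongly type-determining (STD) set: `K = [K] = K↓`. -/
def IsSTD (P : PartialStruct E) (K : Set E) : Prop :=
  P.bra K = K ∧ P.downSet K = K

/-- `c` is the type-cover of `K` (w.r.t. the central cover map `γ`):
the unique central element with `γK = Γ(E)[0,c]`. -/
def IsTypeCover (P : PartialStruct E) (γ : E → E) (K : Set E) (c : E) : Prop :=
  P.IsCentral c ∧ γ '' K = P.centerIntervalSet c

/-- An atom: a nonzero element with no proper nonzero subelement. -/
def IsAtom' (P : PartialStruct E) (a : E) : Prop :=
  a ≠ P.zero ∧ ∀ x, P.le x a → x = P.zero ∨ x = a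

end PartialStruct

/-- A PEA-isomorphism between two partial-addition structures: a bijective
morphism whose inverse is a morphism. -/
structure IsPEAIso {A B : Type} (P : PartialStruct A) (Q : PartialStruct B)
    (f : A → B) : Prop where
  bijective : Function.Bijective f
  map_one : f P.one = Q.one
  map_add : ∀ a b ab, P.padd a b = some ab → Q.padd (f a) (f b) = some (f ab)
  rev_add : ∀ a b s, Q.padd (f a) (f b) = some s → ∃ ab, P.padd a b = some ab

open scoped Classical in
/-- The (coordinatewise) product of a family of partial structures. -/
noncomputable def prodStruct {I : Type} {A : I → Type}
    (Ps : ∀ i, PartialStruct (A i)) : PartialStruct (∀ i, A i) where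
  padd a b :=
    if h : ∀ i, ∃ s, (Ps i).padd (a i) (b i) = some s
    then some fun i => Classical.choose (h i)
    else none
  zero := fun i => (Ps i).zero
  one := fun i => (Ps i).one

/-- A pseudo-effect algebra. -/
structure PEA (E : Type) extends PartialStruct E where
  assoc_def : ∀ a b c : E,
    (∃ ab, padd a b = some ab ∧ ∃ x, padd ab c = some x) ↔
    (∃ bc, padd b c = some bc ∧ ∃ y, padd a bc = some y)
  assoc_eq : ∀ a b c ab bc x y, padd a b = some ab → padd ab c = some x →
    padd b c = some bc → padd a bc = some y → x = y
  exu_right : ∀ a : E, ∃! d, padd a d = some one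
  exu_left : ∀ a : E, ∃! e, padd e a = some one
  shift : ∀ a b ab, padd a b = some ab →
    (∃ d, padd d a = some ab) ∧ (∃ e, padd b e = some ab)
  one_add : ∀ a x, padd one a = some x → a = zero
  add_one : ∀ a x, padd a one = some x → a = zero

namespace PEA

variable {E : Type} (P : PEA E)

/-- Shorthand for the underlying partial structure. -/
abbrev ps : PartialStruct E := P.toPartialStruct

theorem one_add_zero : P.padd P.one P.zero = some P.one := by
  obtain ⟨d, hd, -⟩ := P.exu_right P.one
  have h := P.one_add d P.one hd
  rwa [h] at hd

theorem zero_add_one : P.padd P.zero P.one = some P.one := by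
  obtain ⟨e, he, -⟩ := P.exu_left P.one
  have h := P.add_one e P.one he
  rwa [h] at he

theorem padd_zero (a : E) : P.padd a P.zero = some a := by
  obtain ⟨e, he, -⟩ := P.exu_left a
  have h1 : ∃ ab, P.padd e a = some ab ∧ ∃ x, P.padd ab P.zero = some x :=
    ⟨P.one, he, P.one, P.one_add_zero⟩
  obtain ⟨t, ht, y, hy⟩ := (P.assoc_def e a P.zero).mp h1
  have hxy : P.one = y :=
    P.assoc_eq e a P.zero P.one t P.one y he P.one_add_zero ht hy
  obtain ⟨d, hd, hu⟩ := P.exu_right e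
  have hta : t = a := by
    have h2 : t = d := hu t (by rw [← hxy] at hy; exact hy)
    have h3 : a = d := hu a he
    rw [h2, h3]
  rwa [hta] at ht

theorem zero_padd (a : E) : P.padd P.zero a = some a := by
  obtain ⟨d, hd, -⟩ := P.exu_right a
  have h1 : ∃ bc, P.padd a d = some bc ∧ ∃ y, P.padd P.zero bc = some y :=
    ⟨P.one, hd, P.one, P.zero_add_one⟩
  obtain ⟨t, ht, y, hy⟩ := (P.assoc_def P.zero a d).mpr h1
  have hxy : y = P.one :=
    P.assoc_eq P.zero a d t P.one y P.one ht hy hd P.zero_add_one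
  obtain ⟨e, he, hu⟩ := P.exu_left d
  have hta : t = a := by
    have h2 : t = e := hu t (by rw [hxy] at hy; exact hy)
    have h3 : a = e := hu a hd
    rw [h2, h3]
  rwa [hta] at ht

theorem zero_le (a : E) : P.ps.le P.zero a := ⟨a, P.zero_padd a⟩

theorem le_refl (a : E) : P.ps.le a a := ⟨P.zero, P.padd_zero a⟩

open scoped Classical in
/-- The interval pseudo-effect algebra `E[0,p]` as a partial structure on
the subtype `{x // x ≤ p}`; the sum is defined iff it is defined in `E`
and lies below `p`, and the unit is `p`. -/
noncomputable def intervalStruct (p : E) :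
    PartialStruct {x : E // P.ps.le x p} where
  padd a b := (P.padd a.1 b.1).bind fun s =>
    if h : P.ps.le s p then some ⟨s, h⟩ else none
  zero := ⟨P.zero, P.zero_le p⟩
  one := ⟨p, P.le_refl p⟩

end PEA

/-- The order relation of a complete Boolean algebra structure, made explicit. -/
def cbaLe {X : Type} (inst : CompleteBooleanAlgebra X) (a b : X) : Prop :=
  @LE.le X (by letI := inst; exact inferInstance) a b

end PEApaper

namespace PEApaper

namespace PEA

variable {E : Type} (P : PEA E)

theorem padd_assoc_right {a b c ab x : E} (h₁ : P.padd a b = some ab)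
    (h₂ : P.padd ab c = some x) :
    ∃ bc, P.padd b c = some bc ∧ P.padd a bc = some x := by
  obtain ⟨bc, hbc, y, hy⟩ := (P.assoc_def a b c).mp ⟨ab, h₁, x, h₂⟩
  obtain rfl := P.assoc_eq a b c ab bc x y h₁ h₂ hbc hy
  exact ⟨bc, hbc, hy⟩

theorem padd_assoc_left {a b c bc x : E} (h₁ : P.padd b c = some bc)
    (h₂ : P.padd a bc = some x) :
    ∃ ab, P.padd a b = some ab ∧ P.padd ab c = some x := by
  obtain ⟨ab, hab, y, hy⟩ := (P.assoc_def a b c).mpr ⟨bc, h₁, x, h₂⟩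
  obtain rfl := P.assoc_eq a b c ab bc y x hab hy h₁ h₂
  exact ⟨ab, hab, hy⟩

theorem padd_left_cancel {a b c s : E} (hb : P.padd a b = some s)
    (hc : P.padd a c = some s) : b = c := by
  obtain ⟨e, he, -⟩ := P.exu_left s
  obtain ⟨t, ht, htb⟩ := P.padd_assoc_left hb he
  obtain ⟨u, hu, huc⟩ := P.padd_assoc_left hc he
  obtain rfl : t = u := Option.some.inj (ht.symm.trans hu)
  exact (P.exu_right t).unique htb huc

theorem padd_right_cancel {a b c s : E} (hb : P.padd b a = some s)
    (hc : P.padd c a = some s) : b = c := by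
  obtain ⟨d, hd, -⟩ := P.exu_right s
  obtain ⟨t, ht, htb⟩ := P.padd_assoc_right hb hd
  obtain ⟨u, hu, huc⟩ := P.padd_assoc_right hc hd
  obtain rfl : t = u := Option.some.inj (ht.symm.trans hu)
  exact (P.exu_left t).unique htb huc

theorem eq_zero_of_padd_eq_zero {a b : E} (h : P.padd a b = some P.zero) :
    a = P.zero ∧ b = P.zero := by
  obtain ⟨t, ht, -⟩ := P.padd_assoc_left h P.one_add_zero
  obtain rfl := P.one_add a t ht
  exact ⟨rfl, Option.some.inj ((P.zero_padd b).symm.trans h)⟩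

theorem le_of_padd_right {a b s : E} (h : P.padd a b = some s) : P.ps.le b s :=
  (P.shift a b s h).2

theorem le_trans {a b c : E} (hab : P.ps.le a b) (hbc : P.ps.le b c) : P.ps.le a c := by
  obtain ⟨x, hx⟩ := hab
  obtain ⟨y, hy⟩ := hbc
  obtain ⟨z, -, hz⟩ := P.padd_assoc_right hx hy
  exact ⟨z, hz⟩

theorem le_antisymm {a b : E} (hab : P.ps.le a b) (hba : P.ps.le b a) : a = b := by
  obtain ⟨x, hx⟩ := hab
  obtain ⟨y, hy⟩ := hba
  obtain ⟨z, hxy, hz⟩ := P.padd_assoc_right hx hy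
  obtain rfl := P.padd_left_cancel hz (P.padd_zero a)
  obtain ⟨rfl, -⟩ := P.eq_zero_of_padd_eq_zero hxy
  exact Option.some.inj ((P.padd_zero a).symm.trans hx)

theorem eq_zero_of_le_zero {a : E} (h : P.ps.le a P.zero) : a = P.zero :=
  P.le_antisymm h (P.zero_le a)

/-- The direct decomposition of `E` into `E[0,c]` and `E[0,c']`, with projections `p` and `q`. -/
structure IsSplit (c c' : E) (p q : E → E) : Prop where
  compl : P.padd c c' = some P.one
  p_le : ∀ x, P.ps.le (p x) c
  q_le : ∀ x, P.ps.le (q x) c'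
  sum : ∀ x, P.padd (p x) (q x) = some x
  p_add : ∀ a b ab, P.padd a b = some ab → P.padd (p a) (p b) = some (p ab)
  q_add : ∀ a b ab, P.padd a b = some ab → P.padd (q a) (q b) = some (q ab)
  exists_add : ∀ a b s t, P.padd (p a) (p b) = some s → P.ps.le s c →
    P.padd (q a) (q b) = some t → P.ps.le t c' → ∃ ab, P.padd a b = some ab
  p_of_le : ∀ x, P.ps.le x c → p x = x
  q_of_le : ∀ x, P.ps.le x c' → q x = x
  p_of_le_compl : ∀ x, P.ps.le x c' → p x = P.zero
  q_of_le_compl : ∀ x, P.ps.le x c → q x = P.zero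

variable {P}

theorem _root_.PEApaper.PartialStruct.IsCentral.exists_isSplit {c : E} (hc : P.ps.IsCentral c) :
    ∃ c' p q, P.IsSplit c c' p q := by
  obtain ⟨c', hcc, f, hle, -, -, hfc, hf1, hsum, hadd, hex⟩ := hc
  have hq : ∀ x, P.ps.le x c → (f x).2 = P.zero := by
    rintro x ⟨y, hy⟩
    have := (hadd x y c hy).2
    rw [hfc] at this
    exact (P.eq_zero_of_padd_eq_zero this).1
  have hc'1 : (f c').1 = P.zero := by
    have := (hadd c c' _ hcc).1
    rw [hfc, hf1] at this
    exact P.padd_left_cancel this (P.padd_zero c)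
  have hp : ∀ x, P.ps.le x c' → (f x).1 = P.zero := by
    rintro x ⟨y, hy⟩
    have := (hadd x y c' hy).1
    rw [hc'1] at this
    exact (P.eq_zero_of_padd_eq_zero this).1
  refine ⟨c', fun x => (f x).1, fun x => (f x).2, hcc, fun x => (hle x).1, fun x => (hle x).2,
    hsum, fun a b ab h => (hadd a b ab h).1, fun a b ab h => (hadd a b ab h).2, hex, ?_, ?_, hp, hq⟩
  · intro x hx
    have := hsum x
    rw [hq x hx] at this
    exact Option.some.inj ((P.padd_zero _).symm.trans this)
  · intro x hx
    have := hsum x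
    rw [hp x hx] at this
    exact Option.some.inj ((P.zero_padd _).symm.trans this)

namespace IsSplit

variable {c c' : E} {p q : E → E}

theorem ext (S : P.IsSplit c c' p q) {x y : E} (hp : p x = p y) (hq : q x = q y) : x = y := by
  have h := S.sum x
  rw [hp, hq] at h
  exact Option.some.inj (h.symm.trans (S.sum y))

theorem exists_padd (S : P.IsSplit c c' p q) {a b : E} (ha : P.ps.le a c) (hb : P.ps.le b c') :
    ∃ s, P.padd a b = some s ∧ p s = a ∧ q s = b := by
  obtain ⟨s, hs⟩ := S.exists_add a b a b
    (by rw [S.p_of_le a ha, S.p_of_le_compl b hb, P.padd_zero]) ha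
    (by rw [S.q_of_le b hb, S.q_of_le_compl a ha, P.zero_padd]) hb
  have h₁ := S.p_add a b s hs
  have h₂ := S.q_add a b s hs
  rw [S.p_of_le a ha, S.p_of_le_compl b hb, P.padd_zero] at h₁
  rw [S.q_of_le b hb, S.q_of_le_compl a ha, P.zero_padd] at h₂
  exact ⟨s, hs, (Option.some.inj h₁).symm, (Option.some.inj h₂).symm⟩

theorem sum_comm (S : P.IsSplit c c' p q) (x : E) : P.padd (q x) (p x) = some x := by
  have hp := S.p_le x
  have hq := S.q_le x
  obtain ⟨s, hs⟩ := S.exists_add (q x) (p x) (p x) (q x)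
    (by rw [S.p_of_le_compl _ hq, S.p_of_le _ hp, P.zero_padd]) hp
    (by rw [S.q_of_le _ hq, S.q_of_le_compl _ hp, P.padd_zero]) hq
  have h₁ := S.p_add _ _ s hs
  have h₂ := S.q_add _ _ s hs
  rw [S.p_of_le_compl _ hq, S.p_of_le _ hp, P.zero_padd] at h₁
  rw [S.q_of_le _ hq, S.q_of_le_compl _ hp, P.padd_zero] at h₂
  rw [hs, S.ext (Option.some.inj h₁) (Option.some.inj h₂)]

theorem p_one (S : P.IsSplit c c' p q) : p P.one = c := by
  have h := S.p_add _ _ _ S.compl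
  rw [S.p_of_le c (P.le_refl c), S.p_of_le_compl c' (P.le_refl c'), P.padd_zero] at h
  exact (Option.some.inj h).symm

theorem q_one (S : P.IsSplit c c' p q) : q P.one = c' := by
  have h := S.q_add _ _ _ S.compl
  rw [S.q_of_le c' (P.le_refl c'), S.q_of_le_compl c (P.le_refl c), P.zero_padd] at h
  exact (Option.some.inj h).symm

theorem symm (S : P.IsSplit c c' p q) : P.IsSplit c' c q p where
  compl := by
    have h := S.sum_comm P.one
    rwa [S.p_one, S.q_one] at h
  p_le := S.q_le
  q_le := S.p_le
  sum := S.sum_comm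
  p_add := S.q_add
  q_add := S.p_add
  exists_add a b s t h₁ h₂ h₃ h₄ := S.exists_add a b t s h₃ h₄ h₁ h₂
  p_of_le := S.q_of_le
  q_of_le := S.p_of_le
  p_of_le_compl := S.q_of_le_compl
  q_of_le_compl := S.p_of_le_compl

theorem isCentral (S : P.IsSplit c c' p q) : P.ps.IsCentral c := by
  refine ⟨c', S.compl, fun x => (p x, q x), fun x => ⟨S.p_le x, S.q_le x⟩, ?_, ?_, ?_, ?_, S.sum,
    fun a b ab h => ⟨S.p_add a b ab h, S.q_add a b ab h⟩, S.exists_add⟩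
  · intro x y hxy
    exact S.ext (congrArg Prod.fst hxy) (congrArg Prod.snd hxy)
  · rintro ⟨a, b⟩ ha hb
    obtain ⟨s, -, hp, hq⟩ := S.exists_padd ha hb
    exact ⟨s, Prod.ext hp hq⟩
  · exact Prod.ext (S.p_of_le c (P.le_refl c)) (S.q_of_le_compl c (P.le_refl c))
  · exact Prod.ext S.p_one S.q_one

theorem p_le_self (S : P.IsSplit c c' p q) (x : E) : P.ps.le (p x) x := ⟨_, S.sum x⟩

theorem p_mono (S : P.IsSplit c c' p q) {x y : E} (h : P.ps.le x y) : P.ps.le (p x) (p y) := by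
  obtain ⟨z, hz⟩ := h
  exact ⟨_, S.p_add _ _ _ hz⟩

theorem le_p (S : P.IsSplit c c' p q) {x y : E} (hxy : P.ps.le x y) (hx : P.ps.le x c) :
    P.ps.le x (p y) := by
  rw [← S.p_of_le x hx]
  exact S.p_mono hxy

theorem isMeet (S : P.IsSplit c c' p q) (x : E) : P.ps.IsMeet x c (p x) :=
  ⟨S.p_le_self x, S.p_le x, fun _ hy hyc => S.le_p hy hyc⟩

theorem le_of_components (S : P.IsSplit c c' p q) {x y : E} (hp : P.ps.le (p x) (p y))
    (hq : P.ps.le (q x) (q y)) : P.ps.le x y := by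
  obtain ⟨a, ha⟩ := hp
  obtain ⟨b, hb⟩ := hq
  obtain ⟨u, -, hup, huq⟩ := S.exists_padd
    (P.le_trans (P.le_of_padd_right ha) (S.p_le y)) (P.le_trans (P.le_of_padd_right hb) (S.q_le y))
  rw [← hup] at ha
  rw [← huq] at hb
  obtain ⟨v, hv⟩ := S.exists_add x u _ _ ha (S.p_le y) hb (S.q_le y)
  have hpv := Option.some.inj ((S.p_add _ _ _ hv).symm.trans ha)
  have hqv := Option.some.inj ((S.q_add _ _ _ hv).symm.trans hb)
  exact ⟨u, by rw [hv, S.ext hpv hqv]⟩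

theorem padd_le (S : P.IsSplit c c' p q) {a b s : E} (ha : P.ps.le a c) (hb : P.ps.le b c)
    (hs : P.padd a b = some s) : P.ps.le s c := by
  have h := S.p_add a b s hs
  rw [S.p_of_le a ha, S.p_of_le b hb, hs] at h
  rw [Option.some.inj h]
  exact S.p_le s

theorem exists_padd_le (S : P.IsSplit c c' p q) {a b x : E} (ha : P.ps.le a c)
    (hb : P.ps.le b c') (hax : P.ps.le a x) (hbx : P.ps.le b x) :
    ∃ s, P.padd a b = some s ∧ P.ps.le s x := by
  obtain ⟨s, hs, hps, hqs⟩ := S.exists_padd ha hb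
  refine ⟨s, hs, S.le_of_components ?_ ?_⟩
  · rw [hps]
    exact S.le_p hax ha
  · rw [hqs]
    exact S.symm.le_p hbx hb

theorem isMeet_zero_iff (S : P.IsSplit c c' p q) {d : E} :
    P.ps.IsMeet c d P.zero ↔ P.ps.le d c' := by
  constructor
  · rintro ⟨-, -, h⟩
    have hp := P.eq_zero_of_le_zero (h (p d) (S.p_le d) (S.p_le_self d))
    have hd := S.sum d
    rw [hp, P.zero_padd] at hd
    rw [← Option.some.inj hd]
    exact S.q_le d
  · refine fun hd => ⟨P.zero_le c, P.zero_le d, fun x hxc hxd => ?_⟩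
    rw [← S.p_of_le x hxc, S.p_of_le_compl x (P.le_trans hxd hd)]
    exact P.zero_le _

end IsSplit

theorem intervalStruct_padd_eq_some {h : E} {a b s : {x : E // P.ps.le x h}} :
    (P.intervalStruct h).padd a b = some s ↔ P.padd a.1 b.1 = some s.1 := by
  constructor
  · intro hab
    obtain ⟨t, ht, hts⟩ := Option.bind_eq_some_iff.mp hab
    split_ifs at hts with hth
    rw [ht, ← Option.some.inj hts]
  · intro hab
    refine Option.bind_eq_some_iff.mpr ⟨s.1, hab, ?_⟩
    rw [dif_pos s.2]

theorem intervalStruct_le {h : E} {a b : {x : E // P.ps.le x h}} :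
    (P.intervalStruct h).le a b ↔ P.ps.le a.1 b.1 := by
  constructor
  · rintro ⟨x, hx⟩
    exact ⟨x.1, intervalStruct_padd_eq_some.mp hx⟩
  · rintro ⟨x, hx⟩
    exact ⟨⟨x, P.le_trans (P.le_of_padd_right hx) b.2⟩, intervalStruct_padd_eq_some.mpr hx⟩

theorem IsSplit.isCentral_interval {c c' : E} {p q : E → E} (S : P.IsSplit c c' p q) (h : E) :
    (P.intervalStruct h).IsCentral ⟨p h, S.p_le_self h⟩ := by
  refine ⟨⟨q h, S.symm.p_le_self h⟩, intervalStruct_padd_eq_some.mpr (S.sum h),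
    fun x => (⟨p x, P.le_trans (S.p_le_self x) x.2⟩, ⟨q x, P.le_trans (S.symm.p_le_self x) x.2⟩),
    ?_, ?_, ?_, ?_, rfl, ?_, ?_, ?_⟩
  · exact fun x => ⟨intervalStruct_le.mpr (S.p_mono x.2), intervalStruct_le.mpr (S.symm.p_mono x.2)⟩
  · intro x y hxy
    exact Subtype.ext (S.ext (congrArg (fun z => z.1.1) hxy) (congrArg (fun z => z.2.1) hxy))
  · rintro ⟨a, b⟩ ha hb
    have ha' := P.le_trans (intervalStruct_le.mp ha) (S.p_le h)
    have hb' := P.le_trans (intervalStruct_le.mp hb) (S.q_le h)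
    obtain ⟨s, hs, hsh⟩ := S.exists_padd_le ha' hb' a.2 b.2
    obtain ⟨t, ht, hpt, hqt⟩ := S.exists_padd ha' hb'
    obtain rfl := Option.some.inj (hs.symm.trans ht)
    exact ⟨⟨s, hsh⟩, Prod.ext (Subtype.ext hpt) (Subtype.ext hqt)⟩
  · exact Prod.ext (Subtype.ext (S.p_of_le _ (S.p_le h)))
      (Subtype.ext (S.q_of_le_compl _ (S.p_le h)))
  · exact fun x => intervalStruct_padd_eq_some.mpr (S.sum x)
  · intro a b ab hab
    have hab' := intervalStruct_padd_eq_some.mp hab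
    exact ⟨intervalStruct_padd_eq_some.mpr (S.p_add _ _ _ hab'),
      intervalStruct_padd_eq_some.mpr (S.q_add _ _ _ hab')⟩
  · intro a b s t hs hsc ht htc
    have hs' := intervalStruct_padd_eq_some.mp hs
    have ht' := intervalStruct_padd_eq_some.mp ht
    have hsc' := intervalStruct_le.mp hsc
    have htc' := intervalStruct_le.mp htc
    obtain ⟨ab, hab⟩ := S.exists_add a b s t hs' (P.le_trans hsc' (S.p_le h)) ht'
      (P.le_trans htc' (S.q_le h))
    have hp := Option.some.inj ((S.p_add _ _ _ hab).symm.trans hs')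
    have hq := Option.some.inj ((S.q_add _ _ _ hab).symm.trans ht')
    refine ⟨⟨ab, S.le_of_components ?_ ?_⟩, intervalStruct_padd_eq_some.mpr hab⟩
    · rwa [hp]
    · rwa [hq]

variable (P) in
/-- An element `h` is a monad, relative to the central cover map `γ`. -/
def IsMonad (γ : E → E) (h : E) : Prop := ∀ e, P.ps.le e h → P.ps.IsMeet h (γ e) e

section Monad

variable {γ : E → E} {h : E}

theorem IsMonad.eq_p (hm : P.IsMonad γ h) {e c' : E} {p q : E → E} (he : P.ps.le e h)
    (S : P.IsSplit (γ e) c' p q) : e = p h :=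
  P.le_antisymm (S.le_p he (hm e he).2.1) ((hm e he).2.2 _ (S.p_le_self h) (S.p_le h))

theorem isMonad_iff_subcentral_boolean (hγ : ∀ e, P.ps.IsCentralCover (γ e) e) :
    P.IsMonad γ h ↔
      ((∀ d : {x : E // P.ps.le x h}, (P.intervalStruct h).IsCentral d →
          ∃ c, P.ps.IsCentral c ∧ P.ps.IsMeet h c d.1) ∧
       (∀ x : {x : E // P.ps.le x h}, (P.intervalStruct h).IsCentral x)) := by
  constructor
  · refine fun hm => ⟨fun d _ => ⟨γ d, (hγ d).1, hm d d.2⟩, ?_⟩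
    rintro ⟨x, hx⟩
    obtain ⟨c', p, q, S⟩ := (hγ x).1.exists_isSplit
    have hc := S.isCentral_interval h
    simp only [← hm.eq_p hx S] at hc
    exact hc
  · rintro ⟨hsub, hbool⟩ e he
    obtain ⟨c, hc, hm⟩ := hsub ⟨e, he⟩ (hbool _)
    exact ⟨he, (hγ e).2.1, fun x hxh hxe =>
      hm.2.2 x hxh (P.le_trans hxe ((hγ e).2.2 c hc hm.2.1))⟩

theorem isMonad_iff_eq_of_cover_eq (hγ : ∀ e, P.ps.IsCentralCover (γ e) e) :
    P.IsMonad γ h ↔ ∀ e, P.ps.le e h → γ e = γ h → e = h := by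
  constructor
  · intro hm e he heq
    exact P.le_antisymm he ((hm e he).2.2 h (P.le_refl h) (heq ▸ (hγ h).2.1))
  · intro hall e he
    obtain ⟨c', p, q, S⟩ := (hγ e).1.exists_isSplit
    obtain ⟨s, hs, hsh⟩ := S.exists_padd_le (hγ e).2.1 (S.q_le h) he (S.symm.p_le_self h)
    have hγs : γ s = γ h := by
      refine P.le_antisymm ((hγ s).2.2 _ (hγ h).1 (P.le_trans hsh (hγ h).2.1))
        ((hγ h).2.2 _ (hγ s).1 ?_)
      obtain ⟨d', p', q', T⟩ := (hγ s).1.exists_isSplit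
      refine T.padd_le ?_ (P.le_trans (P.le_of_padd_right hs) (hγ s).2.1) (S.sum h)
      exact P.le_trans (S.p_le h) ((hγ e).2.2 _ (hγ s).1 (P.le_trans ⟨_, hs⟩ (hγ s).2.1))
    rw [hall s hsh hγs] at hs
    have hm := S.isMeet h
    rwa [← P.padd_right_cancel hs (S.sum h)] at hm

theorem isMonad_iff_compl_le (hγ : ∀ e, P.ps.IsCentralCover (γ e) e) :
    P.IsMonad γ h ↔
      ∀ e, P.ps.le e h →
        ∃ g, P.ps.padd (γ e) g = some P.ps.one ∧
          (∀ t, P.ps.padd e t = some h → P.ps.le t g) ∧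
          (∀ s, P.ps.padd s e = some h → P.ps.le s g) := by
  constructor
  · intro hm e he
    obtain ⟨c', p, q, S⟩ := (hγ e).1.exists_isSplit
    have hp := hm.eq_p he S
    have h₁ := S.sum h
    have h₂ := S.sum_comm h
    rw [← hp] at h₁ h₂
    refine ⟨c', S.compl, fun t ht => ?_, fun s hs => ?_⟩
    · rw [P.padd_left_cancel ht h₁]
      exact S.q_le h
    · rw [P.padd_right_cancel hs h₂]
      exact S.q_le h
  · intro hall e he
    obtain ⟨c', p, q, S⟩ := (hγ e).1.exists_isSplit
    obtain ⟨g, hg, hr, -⟩ := hall e he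
    obtain rfl := P.padd_left_cancel hg S.compl
    obtain ⟨t, ht⟩ := he
    have h₁ := S.p_add _ _ _ ht
    rw [S.p_of_le e (hγ e).2.1, S.p_of_le_compl t (hr t ht), P.padd_zero] at h₁
    have hm := S.isMeet h
    rwa [← Option.some.inj h₁] at hm

theorem isMonad_iff_padd_iff_disjoint (hγ : ∀ e, P.ps.IsCentralCover (γ e) e) :
    P.IsMonad γ h ↔
      ∀ e f, P.ps.le e h → P.ps.le f h →
        ((∃ s, P.ps.padd e f = some s ∧ P.ps.le s h) ↔ P.ps.IsMeet (γ e) (γ f) P.ps.zero) := by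
  constructor
  · intro hm e f he hf
    obtain ⟨c', p, q, S⟩ := (hγ e).1.exists_isSplit
    rw [S.isMeet_zero_iff]
    constructor
    · rintro ⟨s, hs, u, hu⟩
      obtain ⟨t, ht, het⟩ := P.padd_assoc_right hs hu
      obtain ⟨g, hg, hr, -⟩ := (isMonad_iff_compl_le hγ).mp hm e he
      obtain rfl := P.padd_left_cancel hg S.compl
      exact (hγ f).2.2 _ S.symm.isCentral (P.le_trans ⟨u, ht⟩ (hr t het))
    · intro hfc
      exact S.exists_padd_le (hγ e).2.1 (P.le_trans (hγ f).2.1 hfc) he hf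
  · intro hall
    refine (isMonad_iff_compl_le hγ).mpr fun e he => ?_
    obtain ⟨c', p, q, S⟩ := (hγ e).1.exists_isSplit
    refine ⟨c', S.compl, fun t ht => ?_, fun s hs => ?_⟩
    · have hd := (hall e t he (P.le_of_padd_right ht)).mp ⟨h, ht, P.le_refl h⟩
      exact P.le_trans (hγ t).2.1 (S.isMeet_zero_iff.mp hd)
    · obtain ⟨h₁, h₂, h₃⟩ := (hall s e ⟨e, hs⟩ he).mp ⟨h, hs, P.le_refl h⟩
      exact P.le_trans (hγ s).2.1 (S.isMeet_zero_iff.mp ⟨h₂, h₁, fun x hx hy => h₃ x hy hx⟩)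

end Monad

end PEA

end PEApaper

open PEApaper PEApaper.PartialStruct in
/-- Theorem 6.7: in a COPEA, for `h ∈ E` the following are equivalent:
(i) `h` is a monad (`e = h ∧ γe` for every `e ≤ h`);
(ii) `h` is both subcentral and boolean;
(iii) for `e ≤ h`, `γe = γh` implies `e = h`;
(iv) for `e ≤ h`, both `e∼ₕ ≤ (γe)'` and `e⁻ₕ ≤ (γe)'`;
(v) for `e, f ≤ h`, `e +ₕ f` exists iff `γe ∧ γf = 0`. -/
theorem stmt19 {E : Type} (P : PEA E) (hco : P.ps.IsCOPEA)
    (γ : E → E) (hγ : ∀ e, P.ps.IsCentralCover (γ e) e) (h : E) :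
    ((∀ e, P.ps.le e h → P.ps.IsMeet h (γ e) e) ↔
      ((∀ d : {x : E // P.ps.le x h}, (P.intervalStruct h).IsCentral d →
          ∃ c, P.ps.IsCentral c ∧ P.ps.IsMeet h c d.1) ∧
       (∀ x : {x : E // P.ps.le x h}, (P.intervalStruct h).IsCentral x))) ∧
    ((∀ e, P.ps.le e h → P.ps.IsMeet h (γ e) e) ↔
      (∀ e, P.ps.le e h → γ e = γ h → e = h)) ∧
    ((∀ e, P.ps.le e h → P.ps.IsMeet h (γ e) e) ↔
      (∀ e, P.ps.le e h →
        ∃ g, P.ps.padd (γ e) g = some P.ps.one ∧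
          (∀ t, P.ps.padd e t = some h → P.ps.le t g) ∧
          (∀ s, P.ps.padd s e = some h → P.ps.le s g))) ∧
    ((∀ e, P.ps.le e h → P.ps.IsMeet h (γ e) e) ↔
      (∀ e f, P.ps.le e h → P.ps.le f h →
        ((∃ s, P.ps.padd e f = some s ∧ P.ps.le s h) ↔
          P.ps.IsMeet (γ e) (γ f) P.ps.zero))) := by
  exact ⟨PEA.isMonad_iff_subcentral_boolean hγ, PEA.isMonad_iff_eq_of_cover_eq hγ,
    PEA.isMonad_iff_compl_le hγ, PEA.isMonad_iff_padd_iff_disjoint hγ⟩
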